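/- Let T and S be commuting contractions on a reflexive Banach space X. If y ∈ (I−T)(I−S)X, then there exists a unique x in the closure of (I−T)(I−S)X with (I−T)(I−S)x = y. -/

import Mathlib

open Filter Topology

section MeanErgodic

variable {X : Type*} [NormedAddCommGroup X] [NormedSpace ℝ X]

theorem norm_pow_apply_le_of_contraction {T : X →L[ℝ] X} (hT : ‖T‖ ≤ 1) (n : ℕ) (x : X) :
    ‖(T ^ n) x‖ ≤ ‖x‖ := by
  induction n with
  | zero => simp
  | succ n ih =>
    rw [pow_succ', mul_apply_eq_comp]
    exact (T.le_of_opNorm_le hT _).trans (by simpa using ih)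

theorem norm_geom_sum_apply_le_of_contraction {T : X →L[ℝ] X} (hT : ‖T‖ ≤ 1) (n : ℕ) (x : X) :
    ‖(∑ k ∈ Finset.range n, T ^ k) x‖ ≤ n * ‖x‖ := by
  rw [sum_apply]
  refine (norm_sum_le_of_le _ fun k _ => norm_pow_apply_le_of_contraction hT k x).trans ?_
  simp

/-- A fixed point of a contraction `T` lying in the closure of the range of `1 - T` is zero. -/
theorem eq_zero_of_fixed_of_mem_closure_range {T : X →L[ℝ] X} (hT : ‖T‖ ≤ 1) {x : X}
    (hx : T x = x) (hmem : x ∈ closure (Set.range ⇑(1 - T))) : x = 0 := by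
  rw [← norm_le_zero_iff]
  refine le_of_forall_pos_le_add fun ε hε => ?_
  obtain ⟨_, ⟨z, rfl⟩, hz⟩ := Metric.mem_closure_iff.1 hmem (ε / 2) (half_pos hε)
  rw [dist_eq_norm] at hz
  obtain ⟨n, hn⟩ := exists_nat_gt (2 * ‖z‖ / (ε / 2))
  rw [div_lt_iff₀ (half_pos hε)] at hn
  have hn0 : (0 : ℝ) < n := by
    by_contra! h
    nlinarith [norm_nonneg z]
  have hfix (k : ℕ) : (T ^ k) x = x := by
    induction k with
    | zero => simp
    | succ k ih => rw [pow_succ, mul_apply_eq_comp, hx, ih]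
  have hsum : (n : ℝ) • x
      = (∑ k ∈ Finset.range n, T ^ k) (x - (1 - T) z) + (z - (T ^ n) z) := by
    have h := congrArg (fun A : X →L[ℝ] X => A z) (geom_sum_mul_neg T n)
    simp only [mul_apply_eq_comp] at h
    rw [map_sub, h, sum_apply, Finset.sum_congr rfl fun k _ => hfix k]
    simp [Nat.cast_smul_eq_nsmul]
  have hle : n * ‖x‖ ≤ n * (ε / 2) + 2 * ‖z‖ := by
    calc n * ‖x‖ = ‖(n : ℝ) • x‖ := by simp [norm_smul]
      _ ≤ n * ‖x - (1 - T) z‖ + (‖z‖ + ‖z‖) := by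
        rw [hsum]
        refine (norm_add_le _ _).trans ?_
        refine add_le_add (norm_geom_sum_apply_le_of_contraction hT _ _) ?_
        refine (norm_sub_le _ _).trans ?_
        gcongr
        exact norm_pow_apply_le_of_contraction hT n z
      _ ≤ n * (ε / 2) + 2 * ‖z‖ := by
        rw [← two_mul]
        gcongr
  rw [zero_add]
  refine le_of_mul_le_mul_left ?_ hn0
  linarith

/-- In a reflexive space, bounded sequences converge weakly along any ultrafilter. -/
theorem exists_forall_dual_tendsto_of_reflexive
    (hrefl : Function.Surjective (NormedSpace.inclusionInDoubleDual ℝ X))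
    {ι : Type*} (U : Ultrafilter ι) {u : ι → X} {C : ℝ} (hu : ∀ i, ‖u i‖ ≤ C) :
    ∃ a : X, ∀ f : X →L[ℝ] ℝ, Tendsto (fun i => f (u i)) U (𝓝 (f a)) := by
  have hlim (f : X →L[ℝ] ℝ) : ∃ l : ℝ, ‖l‖ ≤ C * ‖f‖ ∧ Tendsto (fun i => f (u i)) U (𝓝 l) := by
    have hmem : ∀ i, f (u i) ∈ Metric.closedBall (0 : ℝ) (C * ‖f‖) := fun i => by
      rw [mem_closedBall_zero_iff, mul_comm]
      exact f.le_opNorm_of_le (hu i)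
    obtain ⟨l, hl, hUl⟩ := (isCompact_closedBall (0 : ℝ) (C * ‖f‖)).ultrafilter_le_nhds
      (U.map fun i => f (u i)) (tendsto_principal.2 (.of_forall hmem))
    exact ⟨l, mem_closedBall_zero_iff.1 hl, hUl⟩
  choose L hLC hL using hlim
  let φ : (X →L[ℝ] ℝ) →ₗ[ℝ] ℝ :=
    { toFun := L
      map_add' := fun f g => tendsto_nhds_unique (hL (f + g)) ((hL f).add (hL g))
      map_smul' := fun c f => tendsto_nhds_unique (hL (c • f)) ((hL f).const_smul c) }
  obtain ⟨a, ha⟩ := hrefl (φ.mkContinuous C hLC)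
  refine ⟨a, fun f => ?_⟩
  have h : f a = L f := congrArg (fun ψ : (X →L[ℝ] ℝ) →L[ℝ] ℝ => ψ f) ha
  exact h ▸ hL f

/-- Mean ergodic decomposition relative to an invariant subspace `Y`. -/
theorem exists_fixed_sub_mem_closure_map
    (hrefl : Function.Surjective (NormedSpace.inclusionInDoubleDual ℝ X))
    {T : X →L[ℝ] X} (hT : ‖T‖ ≤ 1) {Y : Submodule ℝ X} (hY : ∀ z ∈ Y, T z ∈ Y)
    {x : X} (hx : x ∈ Y) :
    ∃ a : X, T a = a ∧ x - a ∈ closure (⇑(1 - T) '' Y) := by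
  let u : ℕ → X := fun n => ((n : ℝ) + 1)⁻¹ • (∑ k ∈ Finset.range (n + 1), T ^ k) x
  have hpos (n : ℕ) : (0 : ℝ) < (n : ℝ) + 1 := by positivity
  have hu (n : ℕ) : ‖u n‖ ≤ ‖x‖ := by
    have h := norm_geom_sum_apply_le_of_contraction hT (n + 1) x
    rw [Nat.cast_succ] at h
    rw [norm_smul, norm_inv, Real.norm_of_nonneg (hpos n).le, inv_mul_le_iff₀ (hpos n)]
    exact h
  obtain ⟨a, ha⟩ := exists_forall_dual_tendsto_of_reflexive hrefl (hyperfilter ℕ) hu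
  have hpow (k : ℕ) : (T ^ k) x ∈ Y := by
    induction k with
    | zero => simpa
    | succ k ih => rw [pow_succ']; exact hY _ ih
  have hu_sub (n : ℕ) : x - u n ∈ Y.map (1 - T : X →L[ℝ] X).toLinearMap := by
    have h : x - u n = ((n : ℝ) + 1)⁻¹ • ∑ k ∈ Finset.range (n + 1), (x - (T ^ k) x) := by
      rw [Finset.sum_sub_distrib, smul_sub, ← sum_apply]
      congr 1
      rw [Finset.sum_const, Finset.card_range, ← Nat.cast_smul_eq_nsmul ℝ, Nat.cast_succ,
        inv_smul_smul₀ (hpos n).ne']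
    rw [h]
    refine Submodule.smul_mem _ _ (Submodule.sum_mem _ fun k _ =>
      ⟨∑ i ∈ Finset.range k, (T ^ i) x, Submodule.sum_mem _ fun i _ => hpow i, ?_⟩)
    have h := congrArg (fun A : X →L[ℝ] X => A x) (mul_neg_geom_sum T k)
    simpa using h
  have hu_fix (n : ℕ) : ‖u n - T (u n)‖ ≤ ((n : ℝ) + 1)⁻¹ * (‖x‖ + ‖x‖) := by
    have h := congrArg (fun A : X →L[ℝ] X => A x) (mul_neg_geom_sum T (n + 1))
    have h' : u n - T (u n) = ((n : ℝ) + 1)⁻¹ • (x - (T ^ (n + 1)) x) := by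
      rw [map_smul, ← smul_sub]
      exact congrArg _ h
    rw [h', norm_smul, norm_inv, Real.norm_of_nonneg (hpos n).le]
    gcongr
    exact (norm_sub_le _ _).trans (by gcongr; exact norm_pow_apply_le_of_contraction hT _ x)
  have hu_fix_tendsto : Tendsto (fun n => u n - T (u n)) (hyperfilter ℕ) (𝓝 0) := by
    refine Tendsto.mono_left (squeeze_zero_norm hu_fix ?_) Nat.hyperfilter_le_atTop
    simpa using (tendsto_one_div_add_atTop_nhds_zero_nat (𝕜 := ℝ)).mul_const (‖x‖ + ‖x‖)
  refine ⟨a, ?_, ?_⟩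
  · refine (sub_eq_zero.1 ?_).symm
    refine (SeparatingDual.eq_zero_iff_forall_dual_eq_zero (R := ℝ) _).2 fun f => ?_
    have h := (f.continuous.tendsto 0).comp hu_fix_tendsto
    rw [map_zero] at h
    refine tendsto_nhds_unique ?_ h
    simpa [Function.comp_def] using (ha f).sub (ha (f.comp T))
  · change x - a ∈ closure ((Y.map (1 - T : X →L[ℝ] X).toLinearMap : Submodule ℝ X) : Set X)
    set K := Y.map (1 - T : X →L[ℝ] X).toLinearMap
    by_contra hmem
    obtain ⟨f, c, hfc, hcf⟩ :=
      geometric_hahn_banach_closed_point K.convex.closure isClosed_closure hmem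
    refine hcf.not_ge (le_of_tendsto (f := fun n => f (x - u n)) (x := hyperfilter ℕ) ?_
      (.of_forall fun n => (hfc _ (subset_closure (hu_sub n))).le))
    simpa using (tendsto_const_nhds (x := f x)).sub (ha f)

end MeanErgodic

/-- Let `T` and `S` be commuting contractions on a reflexive Banach space `X`.
If `y ∈ (I-T)(I-S)X`, then there exists a unique `x` in the closure of `(I-T)(I-S)X` with
`(I-T)(I-S)x = y`. -/
theorem stmt1 {X : Type*} [NormedAddCommGroup X] [NormedSpace ℝ X] [CompleteSpace X]
    (hrefl : Function.Surjective (NormedSpace.inclusionInDoubleDual ℝ X))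
    (T S : X →L[ℝ] X) (hT : ‖T‖ ≤ 1) (hS : ‖S‖ ≤ 1) (hTS : T * S = S * T)
    (y : X) (hy : y ∈ Set.range ⇑((1 - T) * (1 - S))) :
    ∃! x : X, x ∈ closure (Set.range ⇑((1 - T) * (1 - S))) ∧ ((1 - T) * (1 - S)) x = y := by
  have hcomm : (1 - T) * (1 - S) = (1 - S) * (1 - T) :=
    (Commute.one_right (1 - T)).sub_right ((Commute.one_left S).sub_left hTS)
  have hrange_T : Set.range ⇑((1 - T) * (1 - S)) ⊆ Set.range ⇑(1 - T) := by
    rintro _ ⟨z, rfl⟩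
    exact ⟨(1 - S) z, rfl⟩
  have hrange_S : Set.range ⇑((1 - T) * (1 - S)) ⊆ Set.range ⇑(1 - S) := by
    rintro _ ⟨z, rfl⟩
    exact ⟨(1 - T) z, by rw [hcomm]; rfl⟩
  obtain ⟨w, rfl⟩ := hy
  refine existsUnique_of_exists_of_unique ?_ ?_
  · obtain ⟨a, ha, hwa⟩ := exists_fixed_sub_mem_closure_map hrefl hS (Y := ⊤)
      (fun _ _ => trivial) (x := w) trivial
    let Y : Submodule ℝ X := (LinearMap.range (1 - S : X →L[ℝ] X).toLinearMap).topologicalClosure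
    have hwaY : w - a ∈ Y := by
      rw [Submodule.top_coe, Set.image_univ] at hwa
      exact hwa
    have hYT : ∀ z ∈ Y, T z ∈ Y := by
      intro z hz
      refine map_mem_closure T.continuous hz ?_
      rintro _ ⟨v, rfl⟩
      refine ⟨T v, ?_⟩
      have h := congrArg (fun A : X →L[ℝ] X => A v) hTS
      simp only [mul_apply_eq_comp] at h
      simp [h]
    obtain ⟨b, hb, hwab⟩ := exists_fixed_sub_mem_closure_map hrefl hT hYT hwaY
    refine ⟨w - a - b, ?_, ?_⟩
    · refine closure_minimal ?_ isClosed_closure hwab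
      rintro _ ⟨z, hz, rfl⟩
      refine map_mem_closure (1 - T).continuous hz ?_
      rintro _ ⟨v, rfl⟩
      exact ⟨v, rfl⟩
    · have ha' : (1 - S) a = 0 := by simp [ha]
      have hb' : (1 - T) b = 0 := by simp [hb]
      have haz : ((1 - T) * (1 - S)) a = 0 := by
        rw [mul_apply_eq_comp, ha', map_zero]
      have hbz : ((1 - T) * (1 - S)) b = 0 := by
        rw [hcomm, mul_apply_eq_comp, hb', map_zero]
      rw [map_sub, map_sub, haz, hbz, sub_zero, sub_zero]
  · rintro p q ⟨hp, hpw⟩ ⟨hq, hqw⟩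
    let R : Submodule ℝ X :=
      (LinearMap.range ((1 - T) * (1 - S) : X →L[ℝ] X).toLinearMap).topologicalClosure
    have hpq : p - q ∈ closure (Set.range ⇑((1 - T) * (1 - S))) := R.sub_mem hp hq
    have hzero : (1 - T) ((1 - S) (p - q)) = 0 := by
      rw [← mul_apply_eq_comp, map_sub, hpw, hqw, sub_self]
    have hS_mem : (1 - S) (p - q) ∈ closure (Set.range ⇑(1 - T)) := by
      refine map_mem_closure (1 - S).continuous (closure_mono hrange_T hpq) ?_
      rintro _ ⟨v, rfl⟩
      exact ⟨(1 - S) v, congrArg (fun A : X →L[ℝ] X => A v) hcomm⟩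
    have hS_zero : (1 - S) (p - q) = 0 :=
      eq_zero_of_fixed_of_mem_closure_range hT (sub_eq_zero.1 hzero).symm hS_mem
    exact sub_eq_zero.1 (eq_zero_of_fixed_of_mem_closure_range hS
      (sub_eq_zero.1 hS_zero).symm (closure_mono hrange_S hpq))
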